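/- arXiv:1907.12287 — 5 statements merged into one kernel-verified Lean document; each statement's English description precedes it below -/
import Mathlib

section
/- Let k ≥ 1 be a natural number such that k+1 is prime. Then the system of equations a·b = c and a + b + c = k² + 2k has a unique solution in integers a, b, c ≥ 1, namely a = b = k and c = k². -/
/-- Let `k ≥ 1` with `k + 1` prime. The system `a * b = c`, `a + b + c = k² + 2k`
has a unique solution in integers `a, b, c ≥ 1`, namely `a = b = k`, `c = k²`. -/
theorem stmt_0 (k : ℕ) (hk : 1 ≤ k) (hp : Nat.Prime (k + 1)) (a b c : ℤ) :
    (1 ≤ a ∧ 1 ≤ b ∧ 1 ≤ c ∧ a * b = c ∧ a + b + c = (k : ℤ) ^ 2 + 2 * k) ↔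
      (a = (k : ℤ) ∧ b = (k : ℤ) ∧ c = (k : ℤ) ^ 2) := by
  constructor
  · rintro ⟨ha, hb, hc, h1, h2⟩
    lift a to ℕ using by omega
    lift b to ℕ using by omega
    subst h1
    have h3 : (a + 1) * (b + 1) = (k + 1) ^ 2 := by
      zify
      linarith
    have h4 := (Nat.Prime.mul_eq_prime_sq_iff (x := a + 1) (y := b + 1)
      hp (by omega) (by omega)).1 h3
    have h5 : a = k := by omega
    have h6 : b = k := by omega
    subst h5
    subst h6
    exact ⟨rfl, rfl, by ring⟩
  · rintro ⟨rfl, rfl, rfl⟩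
    have hk' : (1 : ℤ) ≤ k := by exact_mod_cast hk
    exact ⟨hk', hk', by nlinarith, by ring, by ring⟩
end

section
/- Let f be a polynomial over a field K in variables X_1,…,X_n and let A ⊆ {X_1,…,X_n} with |A| = k. Then spc_k(f|_A) = Σ_{B ⊆ A} (−1)^{k−|B|} · f|_B. -/
open MvPolynomial

/-- `f|_A`: the polynomial obtained from `f` by substituting `0` for every
variable not in `A`. -/
noncomputable def restrictTo {K : Type*} [Field K] {n : ℕ} (A : Finset (Fin n))
    (f : MvPolynomial (Fin n) K) : MvPolynomial (Fin n) K :=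
  aeval (fun i => if i ∈ A then X i else 0) f

/-- `spc k f`: the sum of the monomials of `f` whose support has size exactly `k`. -/
noncomputable def spc {K : Type*} [Field K] {n : ℕ} (k : ℕ)
    (f : MvPolynomial (Fin n) K) : MvPolynomial (Fin n) K :=
  ∑ d ∈ f.support.filter (fun d => d.support.card = k), monomial d (coeff d f)

theorem coeff_restrictTo_aux {K : Type*} [Field K] {n : ℕ} (A : Finset (Fin n))
    (f : MvPolynomial (Fin n) K) (d : Fin n →₀ ℕ) :
    coeff d (restrictTo A f) = if d.support ⊆ A then coeff d f else 0 := by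
  classical
  unfold restrictTo
  induction f using MvPolynomial.induction_on' with
  | add p q hp hq =>
    rw [map_add, coeff_add, hp, hq, coeff_add]
    split_ifs <;> simp
  | monomial e a =>
    rw [aeval_monomial, coeff_monomial]
    by_cases he : e.support ⊆ A
    · have h1 : (e.prod fun i k => (if i ∈ A then (X i : MvPolynomial (Fin n) K) else 0) ^ k)
          = e.prod fun i k => X i ^ k := by
        apply Finset.prod_congr rfl
        intro i hi
        simp only [if_pos (he hi)]
      rw [h1, algebraMap_eq, ← monomial_eq, coeff_monomial]
      by_cases hd : e = d
      · subst hd; simp [he]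
      · simp [hd]
    · have h1 : (e.prod fun i k => (if i ∈ A then (X i : MvPolynomial (Fin n) K) else 0) ^ k)
          = 0 := by
        obtain ⟨i, hi, hiA⟩ := Finset.not_subset.1 he
        apply Finset.prod_eq_zero hi
        simp only [if_neg hiA]
        exact zero_pow (Finsupp.mem_support_iff.1 hi)
      rw [h1]
      by_cases hd : e = d
      · subst hd; simp [he]
      · simp [hd]

theorem coeff_spc_aux {K : Type*} [Field K] {n : ℕ} (k : ℕ)
    (f : MvPolynomial (Fin n) K) (d : Fin n →₀ ℕ) :
    coeff d (spc k f) = if d.support.card = k then coeff d f else 0 := by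
  classical
  unfold spc
  rw [coeff_sum]
  simp only [coeff_monomial]
  rw [Finset.sum_ite_eq']
  by_cases h : coeff d f = 0 <;> simp [h]

theorem sum_aux {K : Type*} [Field K] {n : ℕ} (A S : Finset (Fin n)) (hS : S ⊆ A) :
    ∑ B ∈ A.powerset, (if S ⊆ B then (-1 : K) ^ (A.card - B.card) else 0)
      = if A ⊆ S then 1 else 0 := by
  classical
  have h := Finset.prod_add (fun _ : Fin n => (1 : K)) (fun i => if i ∈ S then 0 else -1) A
  have h2 : ∏ i ∈ A, ((1 : K) + if i ∈ S then 0 else -1) = if A ⊆ S then 1 else 0 := by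
    split_ifs with hA
    · apply Finset.prod_eq_one
      intro i hi
      simp [hA hi]
    · obtain ⟨i, hi, hiS⟩ := Finset.not_subset.1 hA
      apply Finset.prod_eq_zero hi
      simp [hiS]
  rw [← h2, h]
  apply Finset.sum_congr rfl
  intro B hB
  rw [Finset.mem_powerset] at hB
  rw [Finset.prod_const_one, one_mul]
  split_ifs with hSB
  · rw [← Finset.card_sdiff_of_subset hB, ← Finset.prod_const]
    apply Finset.prod_congr rfl
    intro i hi
    rw [if_neg]
    exact fun h => (Finset.mem_sdiff.1 hi).2 (hSB h)
  · obtain ⟨i, hi, hiB⟩ := Finset.not_subset.1 hSB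
    symm
    apply Finset.prod_eq_zero (Finset.mem_sdiff.2 ⟨hS hi, hiB⟩)
    simp [hi]

/-- Inclusion-exclusion: `spc_k (f|_A) = ∑_{B ⊆ A} (-1)^{k - |B|} f|_B` for `|A| = k`. -/
theorem stmt_4 {K : Type*} [Field K] {n : ℕ} (f : MvPolynomial (Fin n) K)
    (A : Finset (Fin n)) (k : ℕ) (hA : A.card = k) :
    spc k (restrictTo A f) =
      ∑ B ∈ A.powerset, C ((-1 : K) ^ (k - B.card)) * restrictTo B f := by
  classical
  subst hA
  ext d
  rw [coeff_spc_aux, coeff_restrictTo_aux, coeff_sum]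
  simp only [coeff_C_mul, coeff_restrictTo_aux]
  by_cases hS : d.support ⊆ A
  · have h := congrArg (· * coeff d f) (sum_aux (K := K) A d.support hS)
    simp only [Finset.sum_mul, ite_mul, zero_mul, one_mul] at h
    simp only [mul_ite, mul_zero]
    rw [h, if_pos hS]
    congr 1
    apply propext
    constructor
    · intro hc
      exact (Finset.eq_of_subset_of_card_le hS hc.ge).ge
    · intro hc
      rw [Finset.Subset.antisymm hS hc]
  · rw [if_neg hS, ite_self]
    symm
    apply Finset.sum_eq_zero
    intro B hB
    rw [if_neg, mul_zero]
    exact fun h => hS (h.trans (Finset.mem_powerset.1 hB))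
end

section
/- Let k ≥ 0 and n ≥ 2k, and let G be a simple graph on n vertices that has a vertex cover of size at most k. Then G is a subgraph of the sun graph S_{n,k} up to relabeling: there is an injective map φ from the vertices of G to {1,…,n} such that for every edge {u,v} of G, {φ(u),φ(v)} is an edge of S_{n,k}. -/
/-- The sun graph `S_{n,k}` on vertex set `Fin n` (0-indexed): the first `2k`
vertices form a clique, every other vertex is adjacent to each of the first `2k`
vertices, and the remaining vertices form an independent set. -/
def sunGraph (n k : ℕ) : SimpleGraph (Fin n) where
  Adj i j := i ≠ j ∧ ((i : ℕ) < 2 * k ∨ (j : ℕ) < 2 * k)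
  symm := by
    refine ⟨?_⟩
    intro i j h
    exact ⟨h.1.symm, h.2.symm⟩
  loopless := by
    refine ⟨?_⟩
    intro i h
    exact h.1 rfl

/-- Every graph on `n` vertices with a vertex cover of size at most `k` is a
subgraph of the sun graph `S_{n,k}` up to relabeling. -/
theorem stmt_11 (n k : ℕ) (hnk : 2 * k ≤ n) (G : SimpleGraph (Fin n))
    (C : Finset (Fin n)) (hC : C.card ≤ k)
    (hcov : ∀ i j, G.Adj i j → i ∈ C ∨ j ∈ C) :
    ∃ φ : Fin n → Fin n, Function.Injective φ ∧
      ∀ u v, G.Adj u v → (sunGraph n k).Adj (φ u) (φ v) := by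
  have hcard : C.card ≤ n := by omega
  let f : {x // x ∈ C} → Fin n := fun x => Fin.castLE hcard (C.equivFin x)
  have hf : Function.Injective f :=
    (Fin.castLE_injective hcard).comp C.equivFin.injective
  let e : {x // x ∈ C} ≃ {y // y ∈ Set.range f} := Equiv.ofInjective f hf
  classical
  let g : Equiv.Perm (Fin n) := Equiv.extendSubtype e
  have hg : ∀ x ∈ C, ((g x : Fin n) : ℕ) < 2 * k := by
    intro x hx
    obtain ⟨y, hy⟩ := Equiv.extendSubtype_mem e x hx
    have h2 : (f y : ℕ) < C.card := (C.equivFin y).isLt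
    change (Equiv.extendSubtype e x : ℕ) < 2 * k
    rw [← hy]
    omega
  refine ⟨g, g.injective, fun u v h => ⟨fun h' => h.ne (g.injective h'), ?_⟩⟩
  exact (hcov u v h).imp (hg u) (hg v)
end

section
/- Let n ≥ 2k ≥ 0. Then VC^s_{n,k} = Σ_{C ⊆ {1,…,2k}, |C| ≤ k} [ ∏_{i,j ∈ {1,…,2k}∖C, i < j} (1 − E_{i,j}) · ∏_{i ∈ C} X_i ] · H_{k−|C|, X}( ∏_{j=2k+1}^{n} ( X_j + ∏_{i ∈ {1,…,2k}∖C} (1 − E_{i,j}) ) ), where H_{d, X}(·) denotes the component of a polynomial whose total degree in the X-variables equals d (i.e., the weighted homogeneous component of degree d with respect to the grading giving each variable X_i weight 1 and each variable E_{i,j} weight 0). -/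
open MvPolynomial Finset

/-- The sun graph vertex cover polynomial `VC^s_{n,k}` over a field `K`, in edge
variables `E_{i,j}` (indexed by `Sum.inl (i,j)` with `i < j`) and node variables
`X_i` (indexed by `Sum.inr i`). The vertices are 0-indexed: the first `2k`
vertices (those with value `< 2k`) form the central clique of the sun graph
`S_{n,k}`; a pair `i < j` is an edge of `S_{n,k}` iff `i < 2k` or `j < 2k`. -/
noncomputable def vcsPoly (K : Type*) [Field K] (n k : ℕ) :
    MvPolynomial ((Fin n × Fin n) ⊕ Fin n) K :=
  ∑ C ∈ Finset.powersetCard k (Finset.univ : Finset (Fin n)),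
    (∏ p ∈ (Finset.univ : Finset (Fin n × Fin n)).filter
        (fun p => p.1 < p.2 ∧ ((p.1 : ℕ) < 2 * k ∨ (p.2 : ℕ) < 2 * k)
          ∧ p.1 ∉ C ∧ p.2 ∉ C),
      (1 - X (Sum.inl p))) *
      ∏ i ∈ C, X (Sum.inr i)

/-- `Hx d f`: the weighted homogeneous component of `f` of degree `d` with respect
to the grading giving each node variable `X_i` weight `1` and each edge variable
`E_{i,j}` weight `0`. -/
noncomputable def Hx {K : Type*} [Field K] {n : ℕ} (d : ℕ)
    (f : MvPolynomial ((Fin n × Fin n) ⊕ Fin n) K) :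
    MvPolynomial ((Fin n × Fin n) ⊕ Fin n) K :=
  ∑ m ∈ f.support.filter (fun m => (∑ i : Fin n, m (Sum.inr i)) = d),
    monomial m (coeff m f)

lemma Hx_eq {K : Type*} [Field K] {n : ℕ} (d : ℕ)
    (f : MvPolynomial ((Fin n × Fin n) ⊕ Fin n) K) :
    Hx d f = weightedHomogeneousComponent
      (Sum.elim (fun _ => 0) (fun _ => 1) : (Fin n × Fin n) ⊕ Fin n → ℕ) d f := by
  classical
  rw [weightedHomogeneousComponent_apply, Hx]
  refine Finset.sum_congr ?_ (fun _ _ => rfl)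
  refine Finset.filter_congr (fun m _ => ?_)
  rw [Finsupp.weight_apply, Finsupp.sum_fintype _ _ (by simp)]
  simp

lemma Hx_prod {K : Type*} [Field K] {n : ℕ} (d : ℕ) (B A : Finset (Fin n)) :
    Hx (K := K) d (∏ j ∈ B, (X (Sum.inr j) + ∏ i ∈ A, (1 - X (Sum.inl (i, j))))) =
      ∑ t ∈ Finset.powersetCard d B, (∏ j ∈ t, X (Sum.inr j)) *
        ∏ j ∈ B \ t, ∏ i ∈ A, (1 - X (Sum.inl (i, j))) := by
  classical
  rw [Hx_eq, Finset.prod_add, map_sum, Finset.powersetCard_eq_filter, Finset.sum_filter]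
  refine Finset.sum_congr rfl (fun t ht => ?_)
  have hw : IsWeightedHomogeneous
      (Sum.elim (fun _ => 0) (fun _ => 1) : (Fin n × Fin n) ⊕ Fin n → ℕ)
      ((∏ j ∈ t, X (Sum.inr j)) * ∏ j ∈ B \ t, ∏ i ∈ A, (1 - X (Sum.inl (i, j))) :
        MvPolynomial ((Fin n × Fin n) ⊕ Fin n) K) t.card := by
    have h1 : IsWeightedHomogeneous
      (Sum.elim (fun _ => 0) (fun _ => 1) : (Fin n × Fin n) ⊕ Fin n → ℕ)
      (∏ j ∈ t, X (Sum.inr j) : MvPolynomial ((Fin n × Fin n) ⊕ Fin n) K) (∑ j ∈ t, 1) :=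
      IsWeightedHomogeneous.prod _ _ _ (fun j _ => isWeightedHomogeneous_X K _ _)
    have h2 : IsWeightedHomogeneous
      (Sum.elim (fun _ => 0) (fun _ => 1) : (Fin n × Fin n) ⊕ Fin n → ℕ)
      (∏ j ∈ B \ t, ∏ i ∈ A, (1 - X (Sum.inl (i, j))) :
        MvPolynomial ((Fin n × Fin n) ⊕ Fin n) K) (∑ j ∈ B \ t, ∑ i ∈ A, 0) := by
      refine IsWeightedHomogeneous.prod _ _ _ (fun j _ =>
        IsWeightedHomogeneous.prod _ _ _ (fun i _ => ?_))
      exact (weightedHomogeneousSubmodule K _ 0).sub_mem (isWeightedHomogeneous_one K _)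
        (isWeightedHomogeneous_X K _ _)
    simpa using h1.mul h2
  split_ifs with hd
  · subst hd
    exact hw.weightedHomogeneousComponent_same
  · exact hw.weightedHomogeneousComponent_ne _ (Ne.symm hd)

/-- The decomposition of the sun graph vertex cover polynomial. -/
theorem stmt_13 {K : Type*} [Field K] (n k : ℕ) (h : 2 * k ≤ n) :
    vcsPoly K n k =
      ∑ C ∈ ((Finset.univ.filter (fun i : Fin n => (i : ℕ) < 2 * k)).powerset).filter
          (fun C => C.card ≤ k),
        ((∏ p ∈ (Finset.univ : Finset (Fin n × Fin n)).filter
            (fun p => (p.1 : ℕ) < 2 * k ∧ (p.2 : ℕ) < 2 * k ∧ p.1 < p.2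
              ∧ p.1 ∉ C ∧ p.2 ∉ C),
          (1 - X (Sum.inl p))) *
          ∏ i ∈ C, X (Sum.inr i)) *
          Hx (k - C.card)
            (∏ j ∈ Finset.univ.filter (fun j : Fin n => 2 * k ≤ (j : ℕ)),
              (X (Sum.inr j) +
                ∏ i ∈ (Finset.univ.filter (fun i : Fin n => (i : ℕ) < 2 * k)) \ C,
                  (1 - X (Sum.inl (i, j))))) := by
  classical
  simp only [Hx_prod, Finset.mul_sum]
  rw [vcsPoly, Finset.sum_sigma']
  refine Finset.sum_bij'
    (fun C _ => ⟨C.filter (fun i : Fin n => (i : ℕ) < 2 * k),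
      C.filter (fun i : Fin n => 2 * k ≤ (i : ℕ))⟩)
    (fun q _ => q.1 ∪ q.2) ?_ ?_ ?_ ?_ ?_
  · intro C hC
    have hc : C.card = k := (Finset.mem_powersetCard.1 hC).2
    have := Finset.card_filter_add_card_filter_not (s := C) (fun i : Fin n => (i : ℕ) < 2 * k)
    simp only [not_lt] at this
    simp only [Finset.mem_sigma, Finset.mem_filter, Finset.mem_powerset, Finset.mem_powersetCard]
    refine ⟨⟨Finset.filter_subset_filter _ (Finset.subset_univ _), by omega⟩,
      Finset.filter_subset_filter _ (Finset.subset_univ _), by omega⟩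
  · rintro ⟨C, t⟩ hq
    simp only [Finset.mem_sigma, Finset.mem_filter, Finset.mem_powerset,
      Finset.mem_powersetCard] at hq
    obtain ⟨⟨hC, hk⟩, ht, htc⟩ := hq
    have hdis : Disjoint C t := by
      rw [Finset.disjoint_left]
      intro a ha hb
      have h1 := (Finset.mem_filter.1 (hC ha)).2
      have h2 := (Finset.mem_filter.1 (ht hb)).2
      omega
    simp only [Finset.mem_powersetCard, Finset.subset_univ, true_and]
    rw [Finset.card_union_of_disjoint hdis]
    omega
  · intro C hC
    ext a
    simp only [Finset.mem_union, Finset.mem_filter]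
    have := lt_or_ge (a : ℕ) (2 * k)
    tauto
  · rintro ⟨C, t⟩ hq
    simp only [Finset.mem_sigma, Finset.mem_filter, Finset.mem_powerset,
      Finset.mem_powersetCard] at hq
    obtain ⟨⟨hC, hk⟩, ht, htc⟩ := hq
    have e1 : (C ∪ t).filter (fun i : Fin n => (i : ℕ) < 2 * k) = C := by
      ext a
      have h1 := fun ha => (Finset.mem_filter.1 (@hC a ha)).2
      have h2 := fun ha => (Finset.mem_filter.1 (@ht a ha)).2
      simp only [Finset.mem_union, Finset.mem_filter]
      have := @not_lt ℕ _ (a : ℕ) (2 * k)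
      tauto
    have e2 : (C ∪ t).filter (fun i : Fin n => 2 * k ≤ (i : ℕ)) = t := by
      ext a
      have h1 := fun ha => (Finset.mem_filter.1 (@hC a ha)).2
      have h2 := fun ha => (Finset.mem_filter.1 (@ht a ha)).2
      simp only [Finset.mem_union, Finset.mem_filter]
      have := @not_lt ℕ _ (a : ℕ) (2 * k)
      tauto
    simp only [e1, e2]
  · intro C hC
    have hX : (∏ i ∈ C, X (Sum.inr i) : MvPolynomial ((Fin n × Fin n) ⊕ Fin n) K) =
        (∏ i ∈ C.filter (fun i : Fin n => (i : ℕ) < 2 * k), X (Sum.inr i)) *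
          ∏ i ∈ C.filter (fun i : Fin n => 2 * k ≤ (i : ℕ)), X (Sum.inr i) := by
      rw [← Finset.prod_filter_mul_prod_filter_not C (fun i : Fin n => (i : ℕ) < 2 * k)]
      simp only [not_lt]
    rw [hX, ← Finset.prod_product_right',
      ← Finset.prod_filter_mul_prod_filter_not (Finset.univ.filter _)
        (fun p : Fin n × Fin n => (p.1 : ℕ) < 2 * k ∧ (p.2 : ℕ) < 2 * k)]
    have f1 : ∀ (a b c d : MvPolynomial ((Fin n × Fin n) ⊕ Fin n) K),
      a * b * (c * d) = a * c * (d * b) := by intros; ring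
    rw [f1]
    congr 1
    · congr 1
      refine Finset.prod_congr ?_ (fun _ _ => rfl)
      ext p
      simp only [Finset.mem_filter, Finset.mem_univ, true_and]
      tauto
    · congr 1
      refine Finset.prod_congr ?_ (fun _ _ => rfl)
      ext p
      simp only [Finset.mem_filter, Finset.mem_univ, true_and, Finset.mem_product,
        Finset.mem_sdiff, Fin.lt_def]
      grind
end

section
/- Let G be a simple graph on vertex set {1,…,n} with edge set E, |E| = m, and let 0 ≤ k ≤ n. Substitute into VC_{n,k}: replace E_{i,j} by 1 − S if {i,j} ∈ E and by 0 otherwise, and replace every X_i by T, where S and T are two fresh variables over a field K. Then the resulting bivariate polynomial equals Σ_{C ⊆ {1,…,n}, |C| = k} S^{u(C)} · T^k, where u(C) is the number of edges of G with both endpoints outside C. In particular, for every i, the coefficient of S^i · T^k equals the number of k-element vertex sets of G that cover exactly m − i edges. -/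
open MvPolynomial Finset

/-- The parameterized vertex cover polynomial `VC_{n,k}` over a field `K`,
in edge variables `E_{i,j}` (indexed by `Sum.inl (i,j)` with `i < j`) and node
variables `X_i` (indexed by `Sum.inr i`). -/
noncomputable def vcPoly (K : Type*) [Field K] (n k : ℕ) :
    MvPolynomial ((Fin n × Fin n) ⊕ Fin n) K :=
  ∑ C ∈ Finset.powersetCard k (Finset.univ : Finset (Fin n)),
    (∏ p ∈ (Finset.univ : Finset (Fin n × Fin n)).filter
        (fun p => p.1 < p.2 ∧ p.1 ∉ C ∧ p.2 ∉ C),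
      (1 - X (Sum.inl p))) *
      ∏ i ∈ C, X (Sum.inr i)

/-- The edge set of `G`, as ordered pairs `(i,j)` with `i < j`. -/
def edgePairs {n : ℕ} (G : SimpleGraph (Fin n)) [DecidableRel G.Adj] :
    Finset (Fin n × Fin n) :=
  (Finset.univ : Finset (Fin n × Fin n)).filter (fun p => p.1 < p.2 ∧ G.Adj p.1 p.2)

/-- Substituting `1 - S` for `E_{i,j}` if `{i,j}` is an edge of `G` and `0`
otherwise, and `T` for every `X_i` (where `S = X 0` and `T = X 1` in `K[S,T]`),
turns `VC_{n,k}` into `∑_{|C| = k} S^{u(C)} T^k`, where `u(C)` is the number of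
edges with both endpoints outside `C`; in particular the coefficient of `S^i T^k`
is the number of `k`-element vertex sets covering exactly `m - i` edges. -/
theorem stmt_16 {K : Type*} [Field K] (n k : ℕ) (hk : k ≤ n)
    (G : SimpleGraph (Fin n)) [DecidableRel G.Adj] :
    aeval (fun s : (Fin n × Fin n) ⊕ Fin n =>
        match s with
        | Sum.inl p => if p.1 < p.2 ∧ G.Adj p.1 p.2 then 1 - X 0 else 0
        | Sum.inr _ => (X 1 : MvPolynomial (Fin 2) K))
      (vcPoly K n k) =
      ∑ C ∈ Finset.powersetCard k (Finset.univ : Finset (Fin n)),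
        (X 0 : MvPolynomial (Fin 2) K) ^
            ((edgePairs G).filter (fun p => p.1 ∉ C ∧ p.2 ∉ C)).card *
          X 1 ^ k
    ∧ ∀ i : ℕ,
        MvPolynomial.coeff (Finsupp.single (0 : Fin 2) i + Finsupp.single 1 k)
          (aeval (fun s : (Fin n × Fin n) ⊕ Fin n =>
              match s with
              | Sum.inl p => if p.1 < p.2 ∧ G.Adj p.1 p.2 then 1 - X 0 else 0
              | Sum.inr _ => (X 1 : MvPolynomial (Fin 2) K))
            (vcPoly K n k)) =
          (((Finset.powersetCard k (Finset.univ : Finset (Fin n))).filter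
              (fun C =>
                (((edgePairs G).filter (fun p => p.1 ∈ C ∨ p.2 ∈ C)).card : ℤ) =
                  ((edgePairs G).card : ℤ) - (i : ℤ))).card : K) := by
  have key : aeval (fun s : (Fin n × Fin n) ⊕ Fin n =>
        match s with
        | Sum.inl p => if p.1 < p.2 ∧ G.Adj p.1 p.2 then 1 - X 0 else 0
        | Sum.inr _ => (X 1 : MvPolynomial (Fin 2) K))
      (vcPoly K n k) =
      ∑ C ∈ Finset.powersetCard k (Finset.univ : Finset (Fin n)),
        (X 0 : MvPolynomial (Fin 2) K) ^
            ((edgePairs G).filter (fun p => p.1 ∉ C ∧ p.2 ∉ C)).card *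
          X 1 ^ k := by
    unfold vcPoly
    rw [map_sum]
    refine Finset.sum_congr rfl fun C hC => ?_
    rw [map_mul, map_prod, map_prod]
    have hc : C.card = k := (Finset.mem_powersetCard.mp hC).2
    congr 1
    · rw [← Finset.prod_const]
      unfold edgePairs
      rw [Finset.filter_filter, Finset.prod_filter, Finset.prod_filter]
      refine Finset.prod_congr rfl fun p _ => ?_
      simp only [map_sub, map_one, aeval_X]
      by_cases h1 : p.1 < p.2 <;> by_cases h2 : G.Adj p.1 p.2 <;> simp [h1, h2]
    · simp [hc]
  refine ⟨key, fun i => ?_⟩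
  rw [key, coeff_sum, Finset.card_filter, Nat.cast_sum]
  refine Finset.sum_congr rfl fun C _ => ?_
  have hcard : ((edgePairs G).filter (fun p => p.1 ∈ C ∨ p.2 ∈ C)).card +
      ((edgePairs G).filter (fun p => p.1 ∉ C ∧ p.2 ∉ C)).card = (edgePairs G).card := by
    rw [← Finset.card_filter_add_card_filter_not (s := edgePairs G)
      (fun p => p.1 ∈ C ∨ p.2 ∈ C)]
    simp only [not_or]
  generalize ((edgePairs G).filter (fun p => p.1 ∉ C ∧ p.2 ∉ C)).card = u at *
  rw [X_pow_eq_monomial, X_pow_eq_monomial, monomial_mul, coeff_monomial]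
  have : (Finsupp.single (0 : Fin 2) u + Finsupp.single 1 k =
      Finsupp.single (0 : Fin 2) i + Finsupp.single 1 k) ↔
      ((((edgePairs G).filter (fun p => p.1 ∈ C ∨ p.2 ∈ C)).card : ℤ) =
                  ((edgePairs G).card : ℤ) - (i : ℤ)) := by
    rw [add_left_inj, (Finsupp.single_injective (0 : Fin 2)).eq_iff]
    omega
  simp only [this, mul_one]
  split_ifs <;> simp
end
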